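/- Fix reals p with 0 < p < 3/4, R with 0 < R ≤ 1/2, and ε > 0. Define E₀ = T₄(H₄^{−1}(R), p) if R ≥ H₄(p), and E₀ = R if R < H₄(p). Then for all sufficiently large n there exists an even linear code C over F₄ of length n and dimension k = ⌊Rn⌋ such that Σ_{w ∈ C^⊥, w ≠ 0} (p/3)^{wt(w)} (1−p)^{n−wt(w)} ≤ 4^{−n(E₀ − ε)}. (This is the combinatorial core of the Gilbert–Varshamov-type existence bound E(R_Q, p) ≥ E₀ for quantum stabilizer codes of rate R_Q = 1 − 2R.) -/

import Mathlib

local notation "F₄" => GaloisField 2 2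

/-- Hamming weight: the number of nonzero coordinates. -/
noncomputable def wt {n : ℕ} (v : Fin n → F₄) : ℕ := Set.ncard {i | v i ≠ 0}

/-- The dual code with respect to the standard inner product. -/
def dualSet {n : ℕ} (C : Submodule F₄ (Fin n → F₄)) : Set (Fin n → F₄) :=
  {w | ∀ v ∈ C, ∑ i, v i * w i = 0}

/-- `T₄(x,y) = x log₄ 3 - x log₄ y - (1-x) log₄ (1-y)`. -/
noncomputable def T4 (x y : ℝ) : ℝ :=
  x * Real.logb 4 3 - x * Real.logb 4 y - (1 - x) * Real.logb 4 (1 - y)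

/-- The quaternary entropy function `H₄(x) = T₄(x,x)`. -/
noncomputable def H4 (x : ℝ) : ℝ := T4 x x

/-- The inverse of `H₄` as an increasing function from `[0, 3/4]` onto `[0,1]`. -/
noncomputable def H4inv (R : ℝ) : ℝ := sInf {x | x ∈ Set.Icc (0 : ℝ) (3 / 4) ∧ H4 x = R}

/-- The Gilbert–Varshamov-type existence-bound exponent. -/
noncomputable def E0 (R p : ℝ) : ℝ := if H4 p ≤ R then T4 (H4inv R) p else R


open Finset

namespace GV

lemma card_F : Nat.card F₄ = 4 := by
  rw [GaloisField.card 2 2 (by norm_num)]; norm_num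

noncomputable instance : Fintype F₄ := Fintype.ofFinite _

lemma fcard_F : Fintype.card F₄ = 4 := by
  rw [← Nat.card_eq_fintype_card, card_F]

lemma pow4 (x : F₄) : x ^ 4 = x := by
  have := FiniteField.pow_card x
  rwa [fcard_F] at this

lemma add_self (x : F₄) : x + x = 0 := CharTwo.add_self_eq_zero x

lemma add_sq' (x y : F₄) : (x + y) ^ 2 = x ^ 2 + y ^ 2 := CharTwo.add_sq x y

lemma pow3 (x : F₄) (hx : x ≠ 0) : x ^ 3 = 1 := by
  have h := pow4 x
  apply mul_left_cancel₀ hx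
  rw [mul_one]
  calc x * x ^ 3 = x ^ 4 := by ring
    _ = x := h

/-- Hermitian form. -/
noncomputable def h {n : ℕ} (x y : Fin n → F₄) : F₄ := ∑ i, x i * y i ^ 2

variable {n : ℕ}

lemma h_add_left (x y z : Fin n → F₄) : h (x + y) z = h x z + h y z := by
  simp [h, add_mul, sum_add_distrib]

lemma h_smul_left (c : F₄) (x z : Fin n → F₄) : h (c • x) z = c * h x z := by
  simp [h, mul_sum, mul_assoc]

lemma h_add_right (x y z : Fin n → F₄) : h x (y + z) = h x y + h x z := by
  simp [h, add_sq', mul_add, sum_add_distrib]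

lemma h_smul_right (c : F₄) (x z : Fin n → F₄) : h x (c • z) = c ^ 2 * h x z := by
  simp only [h, mul_sum, Pi.smul_apply, smul_eq_mul]
  exact sum_congr rfl fun i _ => by ring

lemma h_symm (x y : Fin n → F₄) : h y x = h x y ^ 2 := by
  simp only [h]
  rw [sum_pow_char 2]
  refine sum_congr rfl fun i _ => ?_
  rw [mul_pow, ← pow_mul]
  norm_num
  rw [pow4]; ring

lemma h_single (u : Fin n → F₄) (i : Fin n) : h (Pi.single i 1) u = u i ^ 2 := by
  classical
  rw [h, Finset.sum_eq_single i]
  · simp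
  · intro j _ hj; simp [hj]
  · simp

lemma h_nondeg (u : Fin n → F₄) (hu : ∀ v, h v u = 0) : u = 0 := by
  ext i
  have := hu (Pi.single i 1)
  rw [h_single] at this
  simpa using this

lemma wt_eq [DecidableEq F₄] (v : Fin n → F₄) : wt v = (univ.filter fun i => v i ≠ 0).card := by
  rw [wt, ← Set.ncard_coe_finset]; congr; ext; simp

lemma wt_le (v : Fin n → F₄) : wt v ≤ n := by
  classical
  rw [wt_eq]; exact (card_le_univ _).trans (by simp)

lemma wt_cast (v : Fin n → F₄) : (wt v : F₄) = h v v := by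
  classical
  rw [wt_eq, h, Finset.card_filter]
  push_cast
  refine sum_congr rfl fun i _ => ?_
  by_cases hv : v i = 0
  · simp [hv]
  · simp only [hv, ne_eq, not_false_eq_true, if_true]
    rw [← pow3 _ hv]; ring

lemma even_iff (v : Fin n → F₄) : Even (wt v) ↔ h v v = 0 := by
  rw [← wt_cast, CharP.cast_eq_zero_iff F₄ 2, even_iff_two_dvd]

lemma h_self (v : Fin n → F₄) : h v v = 0 ∨ h v v = 1 := by
  rw [← wt_cast]
  rcases Nat.even_or_odd' (wt v) with ⟨c, hc | hc⟩
  · left; rw [hc]; push_cast; rw [two_mul, add_self]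
  · right; rw [hc]; push_cast; rw [two_mul, add_self, zero_add]

/-- quasi-reflection -/
noncomputable def refl (a : F₄) (w : Fin n → F₄) : (Fin n → F₄) →ₗ[F₄] (Fin n → F₄) where
  toFun x := x + (a * h x w) • w
  map_add' x y := by rw [h_add_left, mul_add, add_smul]; abel
  map_smul' c x := by
    rw [h_smul_left, RingHom.id_apply, smul_add, smul_smul]; congr 2; ring

lemma refl_isom (a : F₄) (w : Fin n → F₄) (ha : a + a ^ 2 + a ^ 3 * h w w = 0)
    (x y : Fin n → F₄) : h (refl a w x) (refl a w y) = h x y := by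
  simp only [refl, LinearMap.coe_mk, AddHom.coe_mk, h_add_left, h_add_right, h_smul_left,
    h_smul_right, h_symm y w]
  linear_combination (h x w * h y w ^ 2) * ha

lemma exists_isom1 (u v : Fin n → F₄) (huv : h u u = h v v) (hne : h u v ≠ h u u) :
    ∃ g : (Fin n → F₄) →ₗ[F₄] (Fin n → F₄), (∀ x y, h (g x) (g y) = h x y) ∧ g u = v := by
  have hb : h u (u + v) ≠ 0 := by
    rw [h_add_right]; intro h0
    exact hne (CharTwo.add_eq_zero.1 h0).symm
  refine ⟨refl (h u (u + v))⁻¹ (u + v), refl_isom _ _ ?_, ?_⟩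
  · have e : h (u + v) (u + v) = h u (u + v) + h u (u + v) ^ 2 := by
      have s : h u u ^ 2 = h u u := (h_symm u u).symm
      rw [h_add_left, h_add_right, h_add_right, add_sq', s, h_symm u v, ← huv]; ring
    rw [e]
    field_simp
    linear_combination (1 + h u (u + v)) * CharTwo.two_eq_zero (R := F₄)
  · simp only [refl, LinearMap.coe_mk, AddHom.coe_mk]
    rw [inv_mul_cancel₀ hb, one_smul, ← add_assoc]
    ext i; simp [add_self]

lemma isom_inj (g : (Fin n → F₄) →ₗ[F₄] (Fin n → F₄)) (hg : ∀ x y, h (g x) (g y) = h x y) :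
    Function.Injective g := by
  rw [injective_iff_map_eq_zero]
  intro x hx
  apply h_nondeg
  intro v
  rw [← hg, hx]; simp [h]

lemma isom_comp (g f : (Fin n → F₄) →ₗ[F₄] (Fin n → F₄)) (hg : ∀ x y, h (g x) (g y) = h x y)
    (hf : ∀ x y, h (f x) (f y) = h x y) : ∀ x y, h ((g ∘ₗ f) x) ((g ∘ₗ f) y) = h x y := by
  intro x y; simp [hg, hf]

lemma exists_omega : ∃ c : F₄, c ≠ 0 ∧ c ≠ 1 := by
  classical
  by_contra! H
  have : (univ : Finset F₄) ⊆ {0, 1} := by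
    intro c _
    by_cases hc : c = 0
    · simp [hc]
    · simp [H c hc]
  have := card_le_card this
  rw [card_univ, fcard_F] at this
  have := this.trans Finset.card_le_two
  omega

lemma omega_trace (c : F₄) (h0 : c ≠ 0) (h1 : c ≠ 1) : c + c ^ 2 = 1 := by
  have h3 := pow3 c h0
  have : (c - 1) * (c ^ 2 + c + 1) = 0 := by linear_combination h3
  rcases mul_eq_zero.1 this with h | h
  · exact absurd (sub_eq_zero.1 h) h1
  · linear_combination h - CharTwo.two_eq_zero (R := F₄)

lemma exists_both (u v : Fin n → F₄) (hu : u ≠ 0) (hv : v ≠ 0) : ∃ y, h y u ≠ 0 ∧ h y v ≠ 0 := by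
  by_contra! H
  have hx : ∃ x, h x u ≠ 0 := by by_contra! K; exact hu (h_nondeg _ K)
  have hz : ∃ x, h x v ≠ 0 := by by_contra! K; exact hv (h_nondeg _ K)
  obtain ⟨x, hx⟩ := hx
  obtain ⟨z, hz⟩ := hz
  have a := H x hx
  have b : h z u = 0 := by by_contra K; exact hz (H z K)
  refine hz ?_
  have := H (x + z) (by rw [h_add_left, b, add_zero]; exact hx)
  rwa [h_add_left, a, zero_add] at this

lemma exists_isom (u v : Fin n → F₄) (hu : u ≠ 0) (hv : v ≠ 0) (huv : h u u = h v v) :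
    ∃ g : (Fin n → F₄) →ₗ[F₄] (Fin n → F₄), (∀ x y, h (g x) (g y) = h x y) ∧ g u = v := by
  by_cases hne : h u v = h u u
  swap
  · exact exists_isom1 u v huv hne
  obtain ⟨c, c0, c1⟩ := exists_omega
  have hc := omega_trace c c0 c1
  have key : ∃ z, h z z = h u u ∧ h u z ≠ h u u ∧ h z v ≠ h u u := by
    rcases h_self u with h0 | h1
    · obtain ⟨y, yu, yv⟩ := exists_both u v hu hv
      have hy : ∃ d : F₄, d + d ^ 2 = h y y := by
        rcases h_self y with e | e
        · exact ⟨0, by simp [e]⟩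
        · exact ⟨c, by rw [e, hc]⟩
      obtain ⟨d, hd⟩ := hy
      have uy : h u y ≠ 0 := by rw [h_symm y u]; exact pow_ne_zero _ yu
      refine ⟨y + (d * (h u y)⁻¹) • u, ?_, ?_, ?_⟩
      · simp only [h_add_left, h_add_right, h_smul_left, h_smul_right, h0]
        rw [h_symm u y, ← hd]
        field_simp
        linear_combination (d + d ^ 2) * h u y ^ 3 * CharTwo.two_eq_zero (R := F₄)
      · rw [h_add_right, h_smul_right, h0]; simpa using uy
      · rw [h_add_left, h_smul_left, hne, h0]; simpa using yv
    · refine ⟨c • u, ?_, ?_, ?_⟩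
      · rw [h_smul_left, h_smul_right, h1, mul_one, ← pow3 c c0]; ring
      · rw [h_smul_right, h1, mul_one]
        intro K
        apply c1
        have := pow3 c c0
        linear_combination this - c * K
      · rw [h_smul_left, hne, h1]; simpa using c1
  obtain ⟨z, z1, z2, z3⟩ := key
  obtain ⟨g, hg, gu⟩ := exists_isom1 u z z1.symm z2
  obtain ⟨f, hf, fz⟩ := exists_isom1 z v (z1.trans huv) (by rw [z1]; exact z3)
  exact ⟨f ∘ₗ g, isom_comp _ _ hf hg, by simp [gu, fz]⟩

/-- the family of even codes of dimension `k` -/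
def IsGood (k : ℕ) (C : Submodule F₄ (Fin n → F₄)) : Prop :=
  (∀ v ∈ C, Even (wt v)) ∧ Module.finrank F₄ C = k

/-- membership of `u` in the Hermitian dual -/
def Orth (C : Submodule F₄ (Fin n → F₄)) (u : Fin n → F₄) : Prop := ∀ v ∈ C, h v u = 0

noncomputable instance : Fintype (Submodule F₄ (Fin n → F₄)) := Fintype.ofFinite _

open Classical in
/-- the family as a finset -/
noncomputable def fam (n k : ℕ) : Finset (Submodule F₄ (Fin n → F₄)) := univ.filter (IsGood k)

open Classical in
/-- the number of codes whose Hermitian dual contains `u` -/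
noncomputable def cnt (k : ℕ) (u : Fin n → F₄) : ℕ := ((fam n k).filter fun C => Orth C u).card

lemma cnt_le (k : ℕ) (u v : Fin n → F₄) (hu : u ≠ 0) (hv : v ≠ 0) (huv : h u u = h v v) :
    cnt k u ≤ cnt k v := by
  obtain ⟨g, hg, gu⟩ := exists_isom u v hu hv huv
  have gi := isom_inj g hg
  refine card_le_card_of_injOn (fun C => C.map g) ?_ ?_
  · intro C hC
    simp only [fam, coe_filter, mem_filter, mem_univ, true_and, Set.mem_ofPred_eq] at hC ⊢
    obtain ⟨⟨h1, h2⟩, h3⟩ := hC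
    refine ⟨⟨?_, ?_⟩, ?_⟩
    · rintro _ ⟨x, hx, rfl⟩
      rw [even_iff, hg, ← even_iff]; exact h1 x hx
    · rw [← h2]; exact (LinearEquiv.finrank_eq (Submodule.equivMapOfInjective g gi C)).symm
    · rintro _ ⟨x, hx, rfl⟩
      rw [← gu, hg]; exact h3 x hx
  · intro C _ D _ hCD
    exact Submodule.map_injective_of_injective gi hCD

open Classical in
lemma dual_card (C : Submodule F₄ (Fin n → F₄)) :
    (univ.filter fun u => Orth C u).card * 4 ^ (Module.finrank F₄ C) ≤ 4 ^ n := by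
  let φ : (Fin n → F₄) → Module.Dual F₄ (Fin n → F₄) := fun u =>
    { toFun := fun v => h v u
      map_add' := fun x y => h_add_left x y u
      map_smul' := fun c x => h_smul_left c x u }
  have hφ : Function.Injective φ := by
    intro u w huw
    ext i
    have := LinearMap.congr_fun huw (Pi.single i 1)
    simp only [φ, LinearMap.coe_mk, AddHom.coe_mk, h_single] at this
    have t := add_sq' (u i) (w i)
    rw [this, add_self] at t
    exact CharTwo.add_eq_zero.1 (by simpa using t)
  have : Finite (Module.Dual F₄ (Fin n → F₄)) := Module.finite_of_finite F₄
  have e := Subspace.finrank_add_finrank_dualAnnihilator_eq C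
  have e1 : (univ.filter fun u => Orth C u).card ≤ Nat.card C.dualAnnihilator := by
    rw [← Fintype.card_subtype, ← Nat.card_eq_fintype_card]
    refine Nat.card_le_card_of_injective
      (fun u => (⟨φ u.1, ?_⟩ : C.dualAnnihilator)) ?_
    · rw [Submodule.mem_dualAnnihilator]; exact fun v hv => u.2 v hv
    · intro a b hab
      exact Subtype.ext (hφ (congrArg Subtype.val hab))
  have e2 : Nat.card C.dualAnnihilator = 4 ^ Module.finrank F₄ C.dualAnnihilator := by
    rw [Module.natCard_eq_pow_finrank (K := F₄), card_F]
  simp only [Module.finrank_fintype_fun_eq_card, Fintype.card_fin] at e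
  calc _ ≤ 4 ^ Module.finrank F₄ C.dualAnnihilator * 4 ^ (Module.finrank F₄ C) := by
        rw [← e2]; exact Nat.mul_le_mul_right _ e1
    _ = 4 ^ n := by rw [← pow_add, add_comm, e]

end GV

namespace GV

variable {n : ℕ}

open Classical in
/-- The norm class. -/
noncomputable def cls (n : ℕ) (s : F₄) : Finset (Fin n → F₄) :=
  univ.filter fun u => u ≠ 0 ∧ h u u = s

lemma h_self_succ {m : ℕ} (x : Fin (m + 1) → F₄) :
    h x x = x 0 ^ 3 + h (Fin.tail x) (Fin.tail x) := by
  simp only [h, Fin.sum_univ_succ, Fin.tail]; ring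

lemma cls_card (hn : 2 ≤ n) (s : F₄) (hs : s = 0 ∨ s = 1) : 4 ^ n ≤ 8 * (cls n s).card := by
  classical
  obtain ⟨m, rfl⟩ : ∃ m, n = m + 1 := ⟨n - 1, by omega⟩
  let f : (Fin m → F₄) → (Fin (m + 1) → F₄) := fun y =>
    Fin.cons (if h y y = s then 0 else 1) y
  have hf : Function.Injective f := fun y z hyz => by
    have := congrArg Fin.tail hyz
    simpa [f] using this
  have hfs : ∀ y, h (f y) (f y) = s := by
    intro y
    rw [h_self_succ]
    simp only [f, Fin.cons_zero, Fin.tail_cons]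
    split_ifs with e
    · simp [e]
    · rcases hs with rfl | rfl <;> rcases h_self y with e' | e' <;> simp_all [add_self]
  have sub : (univ.image f).erase 0 ⊆ cls (m + 1) s := by
    intro x hx
    simp only [mem_erase, mem_image, mem_univ, true_and] at hx
    obtain ⟨h0, y, rfl⟩ := hx
    simp [cls, h0, hfs]
  have c1 := card_le_card sub
  have c2 : (univ.image f).card = 4 ^ m := by
    rw [card_image_of_injective _ hf, card_univ, Fintype.card_fun, fcard_F, Fintype.card_fin]
  have c3 := pred_card_le_card_erase (s := univ.image f) (a := (0 : Fin (m + 1) → F₄))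
  rw [c2] at c3
  have : 4 ^ 1 ≤ 4 ^ m := Nat.pow_le_pow_right (by norm_num) (by omega)
  rw [pow_succ]
  omega

lemma cnt_bound (k : ℕ) (hn : 2 ≤ n) (u : Fin n → F₄) (hu : u ≠ 0) :
    cnt k u * 4 ^ k ≤ 8 * (fam n k).card := by
  classical
  have h1 : (cls n (h u u)).card * cnt k u ≤ ∑ v ∈ cls n (h u u), cnt k v := by
    rw [← smul_eq_mul]
    refine card_nsmul_le_sum _ _ _ fun v hv => ?_
    simp only [cls, mem_filter, mem_univ, true_and] at hv
    exact cnt_le k u v hu hv.1 hv.2.symm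
  have h2 : ∑ v ∈ cls n (h u u), cnt k v ≤
      ∑ C ∈ fam n k, (univ.filter fun u => Orth C u).card := by
    simp only [cnt, card_filter]
    rw [sum_comm]
    exact sum_le_sum fun C _ => sum_le_sum_of_subset (subset_univ _)
  have h3 : (∑ C ∈ fam n k, (univ.filter fun u => Orth C u).card) * 4 ^ k ≤
      (fam n k).card * 4 ^ n := by
    rw [sum_mul, ← smul_eq_mul]
    refine sum_le_card_nsmul _ _ _ fun C hC => ?_
    simp only [fam, mem_filter, mem_univ, true_and] at hC
    have := dual_card C
    rwa [hC.2] at this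
  have h4 := cls_card hn (h u u) (h_self u)
  have h5 : 0 < 4 ^ n := by positivity
  refine Nat.le_of_mul_le_mul_left ?_ h5
  calc 4 ^ n * (cnt k u * 4 ^ k) ≤ 8 * (cls n (h u u)).card * (cnt k u * 4 ^ k) :=
        Nat.mul_le_mul_right _ h4
    _ = 8 * ((cls n (h u u)).card * cnt k u * 4 ^ k) := by ring
    _ ≤ 8 * ((fam n k).card * 4 ^ n) :=
        Nat.mul_le_mul_left _ ((Nat.mul_le_mul_right _ (h1.trans h2)).trans h3)
    _ = _ := by ring

/-- doubling embedding -/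
noncomputable def dbl (n k : ℕ) : (Fin k → F₄) →ₗ[F₄] (Fin n → F₄) where
  toFun x i := if hi : i.1 / 2 < k then x ⟨i.1 / 2, hi⟩ else 0
  map_add' x y := by ext i; simp only [Pi.add_apply]; split_ifs <;> simp
  map_smul' c x := by ext i; simp only [Pi.smul_apply, RingHom.id_apply]; split_ifs <;> simp

lemma sum_dbl (g : ℕ → F₄) (k n : ℕ) (hk : 2 * k ≤ n) (hg : ∀ j, k ≤ j → g j = 0) :
    ∑ i ∈ range n, g (i / 2) = 0 := by
  have : ∀ k, ∑ i ∈ range (2 * k), g (i / 2) = 0 := by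
    intro k
    induction k with
    | zero => simp
    | succ k ih =>
      rw [show 2 * (k + 1) = 2 * k + 1 + 1 by ring, sum_range_succ, sum_range_succ, ih,
        show (2 * k + 1) / 2 = k by omega, show (2 * k) / 2 = k by omega, zero_add, add_self]
  rw [← this k]
  symm
  refine sum_subset (range_subset_range.2 hk) fun i _ hi => hg _ ?_
  rw [mem_range] at hi; omega

lemma fam_nonempty (k : ℕ) (hk : 2 * k ≤ n) : (fam n k).Nonempty := by
  classical
  refine ⟨LinearMap.range (dbl n k), ?_⟩
  simp only [fam, mem_filter, mem_univ, true_and]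
  constructor
  · rintro _ ⟨x, rfl⟩
    rw [even_iff, h]
    rw [← sum_dbl (fun j => if hj : j < k then x ⟨j, hj⟩ * x ⟨j, hj⟩ ^ 2 else 0) k n hk,
      ← Fin.sum_univ_eq_sum_range
        (fun i => (fun j => if hj : j < k then x ⟨j, hj⟩ * x ⟨j, hj⟩ ^ 2 else 0) (i / 2))]
    · refine sum_congr rfl fun i _ => ?_
      simp only [dbl, LinearMap.coe_mk, AddHom.coe_mk]
      split_ifs <;> simp
    · intro j hj; simp [not_lt.2 hj]
  · rw [LinearMap.finrank_range_of_inj]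
    · simp
    · intro x y hxy
      ext j
      have := congrFun hxy ⟨2 * j.1, by have := j.2; omega⟩
      have e : 2 * j.1 / 2 = j.1 := by omega
      simpa [dbl] using this

/-- error probability weight -/
noncomputable def f (q : ℝ) (u : Fin n → F₄) : ℝ := (q / 3) ^ (wt u) * (1 - q) ^ (n - wt u)

lemma f_prod [DecidableEq F₄] (q : ℝ) (u : Fin n → F₄) :
    f q u = ∏ i, (if u i ≠ 0 then q / 3 else 1 - q) := by
  rw [prod_ite, prod_const, prod_const, f, wt_eq]
  congr 2
  have := card_filter_add_card_filter_not (s := (univ : Finset (Fin n))) (fun i => u i ≠ 0)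
  simp only [card_univ, Fintype.card_fin] at this
  omega

lemma f_sum (q : ℝ) : ∑ u : Fin n → F₄, f q u = 1 := by
  classical
  simp only [f_prod]
  rw [← Fintype.prod_sum (fun (_ : Fin n) (a : F₄) => if a ≠ 0 then q / 3 else 1 - q)]
  apply prod_eq_one
  intro i _
  have e : (univ.filter fun a : F₄ => ¬ a ≠ 0) = {0} := by ext; simp
  rw [sum_ite, sum_const, sum_const, filter_ne', e]
  simp [fcard_F]
  ring

lemma f_nonneg (q : ℝ) (h0 : 0 ≤ q) (h1 : q ≤ 1) (u : Fin n → F₄) : 0 ≤ f q u := by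
  have : 0 ≤ 1 - q := by linarith
  unfold f; positivity

open Classical in
/-- the sum over the Hermitian dual -/
noncomputable def S (q : ℝ) (C : Submodule F₄ (Fin n → F₄)) : ℝ :=
  ∑ u ∈ univ.filter (fun u => u ≠ 0 ∧ Orth C u), f q u

lemma exists_code (q : ℝ) (h0 : 0 ≤ q) (h1 : q ≤ 1) (k : ℕ) (hn : 2 ≤ n) (hk : 2 * k ≤ n) :
    ∃ C : Submodule F₄ (Fin n → F₄), IsGood k C ∧ S q C ≤ 8 / 4 ^ k := by
  classical
  have key : ∑ C ∈ fam n k, S q C ≤ ∑ C ∈ fam n k, (8 / 4 ^ k : ℝ) := by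
    have e1 : ∑ C ∈ fam n k, S q C =
        ∑ u ∈ univ.filter (fun u : Fin n → F₄ => u ≠ 0), f q u * cnt k u := by
      simp only [S, cnt, card_filter, ← filter_filter]
      simp only [sum_filter _ (f q), Nat.cast_sum, mul_sum]
      rw [sum_comm]
      refine sum_congr rfl fun u _ => sum_congr rfl fun C _ => ?_
      split_ifs <;> simp
    rw [e1, sum_const, nsmul_eq_mul]
    calc _ ≤ ∑ u ∈ univ.filter (fun u : Fin n → F₄ => u ≠ 0),
            f q u * ((fam n k).card * (8 / 4 ^ k)) := by
          refine sum_le_sum fun u hu => mul_le_mul_of_nonneg_left ?_ (f_nonneg q h0 h1 u)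
          have := cnt_bound k hn u (by simpa using hu)
          have : (cnt k u : ℝ) * 4 ^ k ≤ 8 * (fam n k).card := by exact_mod_cast this
          rw [← mul_div_assoc, le_div_iff₀ (by positivity)]
          linarith
      _ ≤ ∑ u : Fin n → F₄, f q u * ((fam n k).card * (8 / 4 ^ k)) := by
          refine sum_le_sum_of_subset_of_nonneg (subset_univ _) fun u _ _ => ?_
          have := f_nonneg q h0 h1 u
          positivity
      _ = _ := by rw [← sum_mul, f_sum, one_mul]
  obtain ⟨C, hC, hle⟩ := exists_le_of_sum_le (fam_nonempty k hk) key
  simp only [fam, mem_filter, mem_univ, true_and] at hC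
  exact ⟨C, hC, hle⟩

lemma finsum_eq (p : ℝ) (C : Submodule F₄ (Fin n → F₄)) :
    (∑ᶠ w ∈ {w ∈ dualSet C | w ≠ 0}, (p / 3) ^ (wt w) * (1 - p) ^ (n - wt w)) = S p C := by
  classical
  let σ : (Fin n → F₄) → (Fin n → F₄) := fun u i => u i ^ 2
  have hσ : Function.Involutive σ := by
    intro u; ext i
    simp only [σ]
    rw [← pow_mul]; exact pow4 _
  have wσ : ∀ u, wt (σ u) = wt u := by
    intro u; simp [wt, σ]
  rw [finsum_mem_eq_toFinset_sum, S]
  refine sum_bij' (fun u _ => σ u) (fun u _ => σ u) ?_ ?_ (fun u _ => hσ u) (fun u _ => hσ u) ?_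
  · intro w hw
    rw [Set.mem_toFinset] at hw
    simp only [dualSet, Set.mem_ofPred_eq, mem_filter, mem_univ, true_and] at hw ⊢
    refine ⟨fun h0 => hw.2 ?_, fun v hv => ?_⟩
    · rw [← hσ w, h0]; ext i; simp [σ]
    · rw [← hw.1 v hv, h]
      exact sum_congr rfl fun i _ => by rw [show σ w i ^ 2 = w i from congrFun (hσ w) i]
  · intro w hw
    rw [Set.mem_toFinset]
    simp only [dualSet, Set.mem_ofPred_eq, mem_filter, mem_univ, true_and] at hw ⊢
    refine ⟨fun v hv => hw.2 v hv, fun h0 => hw.1 ?_⟩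
    rw [← hσ w, h0]; ext i; simp [σ]
  · intro w _
    rw [f, wσ]

end GV

namespace GV

variable {n : ℕ}

lemma T4_log (x y : ℝ) : T4 x y * Real.log 4 =
    x * Real.log 3 - x * Real.log y - (1 - x) * Real.log (1 - y) := by
  have : Real.log 4 ≠ 0 := (Real.log_pos (by norm_num)).ne'
  simp only [T4, Real.logb]
  field_simp

lemma H4_eq (x : ℝ) : H4 x = Real.qaryEntropy 4 x / Real.log 4 := by
  have : Real.log 4 ≠ 0 := (Real.log_pos (by norm_num)).ne'
  rw [eq_div_iff this, H4, T4_log, Real.qaryEntropy, Real.binEntropy_eq_negMulLog_add_negMulLog_one_sub,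
    Real.negMulLog, Real.negMulLog]
  norm_num
  ring

lemma H4_cont : Continuous H4 := by
  have : H4 = fun x => Real.qaryEntropy 4 x / Real.log 4 := funext H4_eq
  rw [this]
  exact Real.qaryEntropy_continuous.div_const _

lemma H4_mono : StrictMonoOn H4 (Set.Icc 0 (3 / 4)) := by
  have : 0 < Real.log 4 := Real.log_pos (by norm_num)
  have m := Real.qaryEntropy_strictMonoOn (q := 4) (by norm_num)
  intro x hx y hy hxy
  rw [H4_eq, H4_eq]
  refine div_lt_div_of_pos_right (m ?_ ?_ hxy) this
  · norm_num at hx ⊢; exact hx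
  · norm_num at hy ⊢; exact hy

lemma H4_zero : H4 0 = 0 := by simp [H4, T4]

lemma H4_end : H4 (3 / 4) = 1 := by
  have : Real.log 4 ≠ 0 := (Real.log_pos (by norm_num)).ne'
  apply mul_right_cancel₀ this
  rw [H4, T4_log, show (1 : ℝ) - 3 / 4 = 1 / 4 by norm_num, Real.log_div (by norm_num) (by norm_num),
    Real.log_div (by norm_num) (by norm_num), Real.log_one]
  ring

lemma H4inv_mem (R : ℝ) (h0 : 0 < R) (h1 : R < 1) :
    0 < H4inv R ∧ H4inv R < 3 / 4 ∧ H4 (H4inv R) = R := by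
  have hm : H4inv R ∈ {x | x ∈ Set.Icc (0 : ℝ) (3 / 4) ∧ H4 x = R} := by
    apply IsClosed.csInf_mem
    · exact isClosed_Icc.inter (isClosed_eq H4_cont continuous_const)
    · have := intermediate_value_Icc (show (0 : ℝ) ≤ 3 / 4 by norm_num) H4_cont.continuousOn
      rw [H4_zero, H4_end] at this
      obtain ⟨x, hx, e⟩ := this ⟨h0.le, h1.le⟩
      exact ⟨x, hx, e⟩
    · exact ⟨0, fun x hx => hx.1.1⟩
  obtain ⟨⟨a, b⟩, c⟩ := hm
  refine ⟨lt_of_le_of_ne a ?_, lt_of_le_of_ne b ?_, c⟩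
  · intro e; rw [← e, H4_zero] at c; linarith
  · intro e; rw [e, H4_end] at c; linarith

lemma f_exp (q : ℝ) (h0 : 0 < q) (h1 : q < 1) (u : Fin n → F₄) :
    f q u = Real.exp (wt u * (Real.log q - Real.log 3) + (n - wt u) * Real.log (1 - q)) := by
  have h2 : 0 < 1 - q := by linarith
  have h3 : 0 < q / 3 := by linarith
  rw [f, Real.exp_add, ← Real.log_div h0.ne' (by norm_num), ← Nat.cast_sub (wt_le u),
    ← Real.log_pow, ← Real.log_pow, Real.exp_log (by positivity), Real.exp_log (by positivity)]

lemma pow_bound (R : ℝ) (n : ℕ) :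
    (8 : ℝ) / 4 ^ ⌊R * n⌋₊ ≤ 32 * Real.exp (-(n * R * Real.log 4)) := by
  have h1 : R * n < ⌊R * n⌋₊ + 1 := Nat.lt_floor_add_one _
  have l : 0 < Real.log 4 := Real.log_pos (by norm_num)
  have e : (4 : ℝ) ^ ⌊R * n⌋₊ = Real.exp (⌊R * n⌋₊ * Real.log 4) := by
    rw [← Real.log_pow, Real.exp_log (by positivity)]
  have e4 : (4 : ℝ) = Real.exp (Real.log 4) := (Real.exp_log (by norm_num)).symm
  rw [e, div_eq_mul_inv, ← Real.exp_neg]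
  have : Real.exp (-(⌊R * n⌋₊ * Real.log 4)) ≤ 4 * Real.exp (-(n * R * Real.log 4)) := by
    nth_rw 2 [e4]
    rw [← Real.exp_add]
    apply Real.exp_le_exp.2
    nlinarith
  linarith

lemma core (p R : ℝ) (hp0 : 0 < p) (hp1 : p < 3 / 4) (hR0 : 0 < R) (hR1 : R ≤ 1 / 2) :
    ∃ K : ℝ, 0 < K ∧ ∀ n : ℕ, 2 ≤ n → ∃ C : Submodule F₄ (Fin n → F₄),
      IsGood ⌊R * n⌋₊ C ∧ S p C ≤ K * Real.exp (-(n * E0 R p * Real.log 4)) := by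
  classical
  have hk : ∀ n : ℕ, 2 * ⌊R * n⌋₊ ≤ n := by
    intro n
    have : (⌊R * n⌋₊ : ℝ) ≤ R * n := Nat.floor_le (by positivity)
    have h2 : R * n ≤ 1 / 2 * n := by gcongr
    have : (2 * ⌊R * n⌋₊ : ℝ) ≤ n := by linarith
    exact_mod_cast this
  unfold E0
  split_ifs with hc
  swap
  · refine ⟨32, by norm_num, fun n hn => ?_⟩
    obtain ⟨C, hC, hS⟩ := exists_code p hp0.le (by linarith) _ hn (hk n)
    exact ⟨C, hC, hS.trans (pow_bound R n)⟩
  obtain ⟨q0, q1, hq⟩ := H4inv_mem R hR0 (by linarith)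
  generalize H4inv R = q at *
  have hpq : p ≤ q := by
    by_contra! K
    have := H4_mono ⟨q0.le, q1.le⟩ ⟨hp0.le, hp1.le⟩ K
    linarith
  have l4 : 0 < Real.log 4 := Real.log_pos (by norm_num)
  have hα : 0 < Real.log (1 - q) - (Real.log q - Real.log 3) := by
    rw [← Real.log_div q0.ne' (by norm_num), sub_pos]
    exact Real.log_lt_log (by positivity) (by linarith)
  have hβ : 0 ≤ Real.log q - Real.log p + Real.log (1 - p) - Real.log (1 - q) := by
    have a := Real.log_le_log hp0 hpq
    have b := Real.log_le_log (show 0 < 1 - q by linarith) (show 1 - q ≤ 1 - p by linarith)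
    linarith
  have eT := T4_log q p
  have eR := T4_log q q
  rw [show T4 q q = R from hq] at eR
  set α := Real.log (1 - q) - (Real.log q - Real.log 3) with α_def
  set β := Real.log q - Real.log p + Real.log (1 - p) - Real.log (1 - q) with β_def
  refine ⟨32 * Real.exp (β * (Real.log 32 / α)), by positivity, fun n hn => ?_⟩
  obtain ⟨C, hC, hS⟩ := exists_code q q0.le (by linarith) _ hn (hk n)
  have hS := hS.trans (pow_bound R n)
  refine ⟨C, hC, ?_⟩
  have hterm : ∀ u ∈ univ.filter (fun u : Fin n → F₄ => u ≠ 0 ∧ Orth C u),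
      f p u ≤ f q u * (Real.exp (β * (Real.log 32 / α)) *
        Real.exp (n * R * Real.log 4 - n * T4 q p * Real.log 4)) := by
    intro u hu
    have h1 : f q u ≤ S q C := single_le_sum (f := f q)
      (fun v _ => f_nonneg q q0.le (by linarith) v) hu
    have h2 := h1.trans hS
    rw [f_exp q q0 (by linarith)] at h2
    nth_rw 1 [← Real.exp_log (show (0 : ℝ) < 32 by norm_num)] at h2
    rw [← Real.exp_add, Real.exp_le_exp] at h2
    rw [f_exp q q0 (by linarith), f_exp p hp0 (by linarith), ← Real.exp_add, ← Real.exp_add,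
      Real.exp_le_exp]
    have h3 : (q * n - wt u) * α ≤ Real.log 32 := by
      have : (n : ℝ) * R * Real.log 4 = n * (R * Real.log 4) := by ring
      rw [this, eR] at h2
      rw [α_def]
      linarith
    have h4 : q * n - wt u ≤ Real.log 32 / α := by rwa [le_div_iff₀ hα]
    have h5 := mul_le_mul_of_nonneg_left h4 hβ
    have e1 : (n : ℝ) * R * Real.log 4 = n * (R * Real.log 4) := by ring
    have e2 : (n : ℝ) * T4 q p * Real.log 4 = n * (T4 q p * Real.log 4) := by ring
    rw [e1, e2, eR, eT]
    have e3 : β * (q * n - wt u) = (Real.log q - Real.log p + Real.log (1 - p)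
      - Real.log (1 - q)) * (q * n - wt u) := by rw [β_def]
    rw [e3] at h5
    linarith
  calc S p C ≤ S q C * (Real.exp (β * (Real.log 32 / α)) *
        Real.exp (n * R * Real.log 4 - n * T4 q p * Real.log 4)) := by
        rw [S, S, sum_mul]; exact sum_le_sum hterm
    _ ≤ (32 * Real.exp (-(n * R * Real.log 4))) * (Real.exp (β * (Real.log 32 / α)) *
        Real.exp (n * R * Real.log 4 - n * T4 q p * Real.log 4)) :=
        mul_le_mul_of_nonneg_right hS (by positivity)
    _ = 32 * Real.exp (β * (Real.log 32 / α)) * (Real.exp (-(n * R * Real.log 4)) *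
        Real.exp (n * R * Real.log 4 - n * T4 q p * Real.log 4)) := by ring
    _ = _ := by rw [← Real.exp_add]; congr 2; ring

end GV

/-- Combinatorial core of the Gilbert–Varshamov-type existence bound
(Theorem 1): for all large `n` there is an even linear code `C ⊆ F₄ⁿ`
of dimension `⌊Rn⌋` with
`∑_{w ∈ C^⊥, w ≠ 0} (p/3)^{wt w} (1-p)^{n - wt w} ≤ 4^{-n(E₀ - ε)}`. -/
theorem gilbert_varshamov_existence (p R ε : ℝ)
    (hp0 : 0 < p) (hp1 : p < 3 / 4) (hR0 : 0 < R) (hR1 : R ≤ 1 / 2) (hε : 0 < ε) :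
    ∃ N : ℕ, ∀ n : ℕ, N ≤ n →
      ∃ C : Submodule F₄ (Fin n → F₄),
        (∀ v ∈ C, Even (wt v)) ∧
        Module.finrank F₄ C = ⌊R * n⌋₊ ∧
        (∑ᶠ w ∈ {w ∈ dualSet C | w ≠ 0},
            (p / 3) ^ (wt w) * (1 - p) ^ (n - wt w))
          ≤ (4 : ℝ) ^ (-((n : ℝ) * (E0 R p - ε))) := by

  obtain ⟨K, hK, hcore⟩ := GV.core p R hp0 hp1 hR0 hR1
  have l4 : 0 < Real.log 4 := Real.log_pos (by norm_num)
  obtain ⟨M, hM⟩ := exists_nat_ge (Real.log K / (ε * Real.log 4))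
  refine ⟨max M 2, fun n hn => ?_⟩
  obtain ⟨C, ⟨hC1, hC2⟩, hS⟩ := hcore n ((le_max_right _ _).trans hn)
  refine ⟨C, hC1, hC2, ?_⟩
  rw [GV.finsum_eq]
  refine hS.trans ?_
  have hMn : (M : ℝ) ≤ n := by exact_mod_cast (le_max_left _ _).trans hn
  have h1 := hM.trans hMn
  rw [div_le_iff₀ (by positivity)] at h1
  rw [Real.rpow_def_of_pos (by norm_num)]
  nth_rw 1 [← Real.exp_log hK]
  rw [← Real.exp_add, Real.exp_le_exp]
  nlinarith
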